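/- Let Λ be a semiperfect Noetherian ring and M a finitely generated Λ-module. Define M_0 := M and M_{n+1} := M_n · J(End_Λ(M_n)), the submodule of M_n generated by images of all endomorphisms in the Jacobson radical of End_Λ(M_n). If Λ is an artin algebra, then M_{n+1} ⊊ M_n whenever M_n ≠ 0; in particular the sequence (M_n) is eventually 0. -/

import Mathlib

/-- One step of the radical series construction: `N · J(End_Λ(N))`, the submodule of `M`
generated by the images of all endomorphisms of `N` lying in the Jacobson radical of
`End_Λ(N)`. -/
def radStep {Λ : Type*} [Ring Λ] {M : Type*} [AddCommGroup M] [Module Λ M]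
    (N : Submodule Λ M) : Submodule Λ M :=
  ⨆ f ∈ (⊥ : Ideal (Module.End Λ N)).jacobson, Submodule.map N.subtype (LinearMap.range f)

/-- The sequence `M_0 = M`, `M_{n+1} = M_n · J(End_Λ(M_n))`. -/
def radSeq (Λ : Type*) [Ring Λ] (M : Type*) [AddCommGroup M] [Module Λ M] :
    ℕ → Submodule Λ M
  | 0 => ⊤
  | n + 1 => radStep (radSeq Λ M n)

theorem radStep_le_self {Λ : Type*} [Ring Λ] {M : Type*} [AddCommGroup M] [Module Λ M]
    (N : Submodule Λ M) : radStep N ≤ N :=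
  iSup₂_le fun _ _ => Submodule.map_subtype_le _ _

theorem mem_jacobson_smul_of_mem_radStep {Λ : Type*} [Ring Λ] {M : Type*} [AddCommGroup M]
    [Module Λ M] (N : Submodule Λ M) (y : M) (hy : y ∈ radStep N) :
    ∃ x ∈ Ring.jacobson (Module.End Λ N) • (⊤ : Submodule (Module.End Λ N) N), (x : M) = y := by
  unfold radStep at hy
  rw [iSup_subtype'] at hy
  induction hy using Submodule.iSup_induction' with
  | mem f x hx =>
    obtain ⟨_, ⟨z, rfl⟩, rfl⟩ := hx
    refine ⟨f.1 z, ?_, rfl⟩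
    have hf : f.1 ∈ Ring.jacobson (Module.End Λ N) :=
      (Ideal.jacobson_bot (R := Module.End Λ N)).le f.2
    exact Submodule.smul_mem_smul hf (Submodule.mem_top (x := z))
  | zero => exact ⟨0, zero_mem _, rfl⟩
  | add x y _ _ hx hy =>
    obtain ⟨a, ha, rfl⟩ := hx
    obtain ⟨b, hb, rfl⟩ := hy
    exact ⟨a + b, add_mem ha hb, rfl⟩

theorem finite_end_of_artin (R : Type*) [CommRing R]
    {Λ : Type*} [Ring Λ] [Algebra R Λ] [Module.Finite R Λ]
    (N : Type*) [AddCommGroup N] [Module Λ N] [Module.Finite Λ N] :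
    Module.Finite (Module.End Λ N) N := by
  let : Module R N := Module.compHom N (algebraMap R Λ)
  have : IsScalarTower R Λ N := ⟨fun r l x => by
    change (r • l) • x = algebraMap R Λ r • (l • x)
    rw [Algebra.smul_def, mul_smul]⟩
  have : SMulCommClass R Λ N := IsScalarTower.to_smulCommClass
  have : SMulCommClass Λ R N := SMulCommClass.symm _ _ _
  have : Module.Finite R N := Module.Finite.trans Λ N
  have : IsScalarTower R (Module.End Λ N) N := ⟨fun _ _ _ => rfl⟩
  exact Module.Finite.of_restrictScalars_finite R (Module.End Λ N) N

theorem radStep_lt_self (R : Type*) [CommRing R]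
    {Λ : Type*} [Ring Λ] [Algebra R Λ] [Module.Finite R Λ] [IsArtinianRing Λ]
    {M : Type*} [AddCommGroup M] [Module Λ M] [Module.Finite Λ M]
    (N : Submodule Λ M) (hN : N ≠ ⊥) : radStep N < N := by
  refine lt_of_le_of_ne (radStep_le_self N) fun h => hN ?_
  have : IsNoetherian Λ M := isNoetherian_of_isNoetherianRing_of_finite Λ M
  have : Module.Finite (Module.End Λ N) N := finite_end_of_artin R N
  have key : (⊤ : Submodule (Module.End Λ N) N) = ⊥ := by
    refine Submodule.FG.eq_bot_of_le_jacobson_smul Module.Finite.fg_top fun x _ => ?_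
    obtain ⟨z, hz, hzx⟩ := mem_jacobson_smul_of_mem_radStep N x (h.symm ▸ x.2)
    rwa [Subtype.ext hzx] at hz
  rw [eq_bot_iff]
  intro x hx
  have : (⟨x, hx⟩ : N) ∈ (⊥ : Submodule (Module.End Λ N) N) := key ▸ Submodule.mem_top
  rw [Submodule.mem_bot] at this
  exact congrArg Subtype.val this

/-- Let `Λ` be an artin algebra and `M` a finitely generated `Λ`-module.
With `M_0 = M` and `M_{n+1} = M_n · J(End_Λ(M_n))`, we have `M_{n+1} ⊊ M_n` whenever
`M_n ≠ 0`; in particular the sequence `(M_n)` is eventually `0`. -/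
theorem radSeq_strict_descent
    {R : Type*} [CommRing R] [IsArtinianRing R]
    {Λ : Type*} [Ring Λ] [Algebra R Λ] [Module.Finite R Λ] [IsArtinianRing Λ]
    (M : Type*) [AddCommGroup M] [Module Λ M] [Module.Finite Λ M] :
    (∀ n : ℕ, radSeq Λ M n ≠ ⊥ → radSeq Λ M (n + 1) < radSeq Λ M n) ∧
    (∃ m : ℕ, radSeq Λ M m = ⊥) := by
  have H : ∀ n : ℕ, radSeq Λ M n ≠ ⊥ → radSeq Λ M (n + 1) < radSeq Λ M n :=
    fun n hn => radStep_lt_self R (radSeq Λ M n) hn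
  refine ⟨H, ?_⟩
  by_contra! hne
  have : IsArtinian Λ M := inferInstance
  exact (WellFounded.not_rel_apply_succ (r := (· < ·)) (radSeq Λ M)).elim
    fun n hn => hn (H n (hne n))
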